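/- Let R be either L or H and let S be a reduced proper subset of R. Suppose Int(S,R) contains a polynomial of the form f(x) = γ(x−β)/p, where: (i) p is an odd prime; (ii) γ ∈ R but γ/p ∉ R; and (iii) β ∈ S, and writing β = b₀+b₁i+b₂j+b₃k (with all bᵢ ∈ ℤ if β ∈ L, and all bᵢ ∈ ℤ+1/2 if β ∈ H∖L), there is some 1 ≤ i ≤ 3 with p ∤ 2bᵢ. Then S is not a ringset of R. -/

import Mathlib

noncomputable section

open Polynomial

abbrev 𝔻 : Type := Quaternion ℚ

def qi : 𝔻 := QuaternionAlgebra.mk 0 1 0 0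
def qj : 𝔻 := QuaternionAlgebra.mk 0 0 1 0
def qk : 𝔻 := QuaternionAlgebra.mk 0 0 0 1

def isIntQ (q : ℚ) : Prop := ∃ z : ℤ, q = (z : ℚ)
def isHalfOddQ (q : ℚ) : Prop := ∃ z : ℤ, q = (z : ℚ) + 1/2

def Lip : Set 𝔻 :=
  {α | isIntQ α.re ∧ isIntQ α.imI ∧ isIntQ α.imJ ∧ isIntQ α.imK}

def HurOff : Set 𝔻 :=
  {α | isHalfOddQ α.re ∧ isHalfOddQ α.imI ∧ isHalfOddQ α.imJ ∧ isHalfOddQ α.imK}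

def Hur : Set 𝔻 := Lip ∪ HurOff

def qnorm (α : 𝔻) : ℚ := α.re ^ 2 + α.imI ^ 2 + α.imJ ^ 2 + α.imK ^ 2

def minPoly (α : 𝔻) : Polynomial ℚ :=
  if α.imI = 0 ∧ α.imJ = 0 ∧ α.imK = 0 then X - C α.re
  else X ^ 2 - C (2 * α.re) * X + C (qnorm α)

def classOf (R : Set 𝔻) (m : Polynomial ℤ) : Set 𝔻 :=
  {α | α ∈ R ∧ minPoly α = m.map (Int.castRingHom ℚ)}

def IntPolys (S R : Set 𝔻) : Set (Polynomial 𝔻) :=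
  {f | ∀ α ∈ S, f.eval α ∈ R}

def IsRingset (S R : Set 𝔻) : Prop :=
  ∀ f ∈ IntPolys S R, ∀ g ∈ IntPolys S R, f * g ∈ IntPolys S R

def transSet (S : Set 𝔻) (a : ℤ) : Set 𝔻 := (fun α => α + (a : 𝔻)) '' S

def scaleSet (n : ℤ) (R : Set 𝔻) : Set 𝔻 := (fun α => (n : 𝔻) * α) '' R

def IsReducedIn (S R : Set 𝔻) : Prop :=
  (∃ m : Polynomial ℤ, m.Monic ∧ m.natDegree = 2 ∧ S ⊆ classOf R m) ∧
  (∀ a n : ℤ, 2 ≤ n → ¬ (transSet S a ⊆ scaleSet n R))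

def diffs (S : Set 𝔻) : Set 𝔻 := {δ | ∃ α ∈ S, ∃ β ∈ S, δ = α - β}

def normsOf (S : Set 𝔻) : Set ℤ := {n : ℤ | ∃ δ ∈ diffs S, (n : ℚ) = qnorm δ}

def gam (S : Set 𝔻) : ℕ := sSup {g : ℕ | ∀ t ∈ normsOf S, (g : ℤ) ∣ t}

def starSet (S R : Set 𝔻) : Set 𝔻 :=
  {β | ∃ α ∈ S, ∃ u v : 𝔻, u ∈ R ∧ v ∈ R ∧ u * v = 1 ∧ v * u = 1 ∧ β = u * α * v}

def idealGen (R : Set 𝔻) (x : 𝔻) : Set 𝔻 :=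
  {β | ∃ n : ℕ, ∃ a b : Fin n → 𝔻, (∀ k, a k ∈ R) ∧ (∀ k, b k ∈ R) ∧ β = ∑ k, a k * x * b k}

@[simp] lemma qi_re : qi.re = 0 := rfl
@[simp] lemma qi_imI : qi.imI = 1 := rfl
@[simp] lemma qi_imJ : qi.imJ = 0 := rfl
@[simp] lemma qi_imK : qi.imK = 0 := rfl
@[simp] lemma qj_re : qj.re = 0 := rfl
@[simp] lemma qj_imI : qj.imI = 0 := rfl
@[simp] lemma qj_imJ : qj.imJ = 1 := rfl
@[simp] lemma qj_imK : qj.imK = 0 := rfl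
@[simp] lemma qk_re : qk.re = 0 := rfl
@[simp] lemma qk_imI : qk.imI = 0 := rfl
@[simp] lemma qk_imJ : qk.imJ = 0 := rfl
@[simp] lemma qk_imK : qk.imK = 1 := rfl

lemma qi_mem_Lip : qi ∈ Lip := by
  refine ⟨⟨0, ?_⟩, ⟨1, ?_⟩, ⟨0, ?_⟩, ⟨0, ?_⟩⟩ <;> simp

lemma qj_mem_Lip : qj ∈ Lip := by
  refine ⟨⟨0, ?_⟩, ⟨0, ?_⟩, ⟨1, ?_⟩, ⟨0, ?_⟩⟩ <;> simp

lemma qk_mem_Lip : qk ∈ Lip := by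
  refine ⟨⟨0, ?_⟩, ⟨0, ?_⟩, ⟨0, ?_⟩, ⟨1, ?_⟩⟩ <;> simp

lemma zero_mem_Lip : (0 : 𝔻) ∈ Lip := by
  refine ⟨⟨0, ?_⟩, ⟨0, ?_⟩, ⟨0, ?_⟩, ⟨0, ?_⟩⟩ <;> exact Int.cast_zero.symm

lemma one_mem_Lip : (1 : 𝔻) ∈ Lip := by
  refine ⟨⟨1, Int.cast_one.symm⟩, ⟨0, ?_⟩, ⟨0, ?_⟩, ⟨0, ?_⟩⟩ <;> exact Int.cast_zero.symm

/-- The Lipschitz quaternions as a subring. -/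
def lipSubring : Subring 𝔻 where
  carrier := Lip
  zero_mem' := zero_mem_Lip
  one_mem' := one_mem_Lip
  neg_mem' := by
    rintro x ⟨⟨a, ha⟩, ⟨b, hb⟩, ⟨c, hc⟩, ⟨d, hd⟩⟩
    refine ⟨⟨-a, ?_⟩, ⟨-b, ?_⟩, ⟨-c, ?_⟩, ⟨-d, ?_⟩⟩ <;> simp [ha, hb, hc, hd]
  add_mem' := by
    rintro x y ⟨⟨a, ha⟩, ⟨b, hb⟩, ⟨c, hc⟩, ⟨d, hd⟩⟩ ⟨⟨a', ha'⟩, ⟨b', hb'⟩, ⟨c', hc'⟩, ⟨d', hd'⟩⟩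
    refine ⟨⟨a + a', ?_⟩, ⟨b + b', ?_⟩, ⟨c + c', ?_⟩, ⟨d + d', ?_⟩⟩ <;>
      simp [ha, hb, hc, hd, ha', hb', hc', hd']
  mul_mem' := by
    rintro x y ⟨⟨a, ha⟩, ⟨b, hb⟩, ⟨c, hc⟩, ⟨d, hd⟩⟩ ⟨⟨a', ha'⟩, ⟨b', hb'⟩, ⟨c', hc'⟩, ⟨d', hd'⟩⟩
    refine ⟨⟨a * a' - b * b' - c * c' - d * d', ?_⟩, ⟨a * b' + b * a' + c * d' - d * c', ?_⟩,
      ⟨a * c' - b * d' + c * a' + d * b', ?_⟩, ⟨a * d' + b * c' - c * b' + d * a', ?_⟩⟩ <;>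
      simp [ha, hb, hc, hd, ha', hb', hc', hd']

/-- The Hurwitz quaternions are the integer combinations of `(1 + i + j + k) / 2`, `i`, `j`, `k`. -/
lemma mem_Hur_iff (x : 𝔻) : x ∈ Hur ↔ ∃ a b c d : ℤ, x.re = a / 2 ∧ x.imI = a / 2 + b ∧
    x.imJ = a / 2 + c ∧ x.imK = a / 2 + d := by
  constructor
  · rintro (⟨⟨a, ha⟩, ⟨b, hb⟩, ⟨c, hc⟩, ⟨d, hd⟩⟩ | ⟨⟨a, ha⟩, ⟨b, hb⟩, ⟨c, hc⟩, ⟨d, hd⟩⟩)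
    · refine ⟨2 * a, b - a, c - a, d - a, ?_, ?_, ?_, ?_⟩ <;> push_cast <;> linarith
    · refine ⟨2 * a + 1, b - a, c - a, d - a, ?_, ?_, ?_, ?_⟩ <;> push_cast <;> linarith
  · rintro ⟨a, b, c, d, ha, hb, hc, hd⟩
    obtain ⟨m, rfl | rfl⟩ := Int.even_or_odd' a
    · left
      refine ⟨⟨m, ?_⟩, ⟨m + b, ?_⟩, ⟨m + c, ?_⟩, ⟨m + d, ?_⟩⟩ <;> push_cast at * <;> linarith
    · right
      refine ⟨⟨m, ?_⟩, ⟨m + b, ?_⟩, ⟨m + c, ?_⟩, ⟨m + d, ?_⟩⟩ <;> push_cast at * <;> linarith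

/-- The Hurwitz quaternions as a subring. -/
def hurSubring : Subring 𝔻 where
  carrier := Hur
  zero_mem' := Or.inl zero_mem_Lip
  one_mem' := Or.inl one_mem_Lip
  neg_mem' := by
    intro x hx
    obtain ⟨a, b, c, d, ha, hb, hc, hd⟩ := (mem_Hur_iff x).1 hx
    refine (mem_Hur_iff _).2 ⟨-a, -b, -c, -d, ?_, ?_, ?_, ?_⟩ <;>
      simp [ha, hb, hc, hd] <;> ring
  add_mem' := by
    intro x y hx hy
    obtain ⟨a, b, c, d, ha, hb, hc, hd⟩ := (mem_Hur_iff x).1 hx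
    obtain ⟨a', b', c', d', ha', hb', hc', hd'⟩ := (mem_Hur_iff y).1 hy
    refine (mem_Hur_iff _).2 ⟨a + a', b + b', c + c', d + d', ?_, ?_, ?_, ?_⟩ <;>
      simp [ha, hb, hc, hd, ha', hb', hc', hd'] <;> ring
  mul_mem' := by
    intro x y hx hy
    obtain ⟨a, b, c, d, ha, hb, hc, hd⟩ := (mem_Hur_iff x).1 hx
    obtain ⟨a', b', c', d', ha', hb', hc', hd'⟩ := (mem_Hur_iff y).1 hy
    refine (mem_Hur_iff _).2
      ⟨-(a * a') - a * (b' + c' + d') - a' * (b + c + d) - 2 * (b * b' + c * c' + d * d'),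
        a * a' + a * (b' + d') + a' * (b + c) + (c * d' - d * c') + (b * b' + c * c' + d * d'),
        a * a' + a * (c' + b') + a' * (c + d) + (d * b' - b * d') + (b * b' + c * c' + d * d'),
        a * a' + a * (d' + c') + a' * (d + b) + (b * c' - c * b') + (b * b' + c * c' + d * d'),
        ?_, ?_, ?_, ?_⟩ <;>
      simp [ha, hb, hc, hd, ha', hb', hc', hd'] <;> ring

lemma add_self_mem_Lip_of_mem_Hur {x : 𝔻} (hx : x ∈ Hur) : x + x ∈ Lip := by
  obtain ⟨a, b, c, d, ha, hb, hc, hd⟩ := (mem_Hur_iff x).1 hx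
  refine ⟨⟨a, ?_⟩, ⟨a + 2 * b, ?_⟩, ⟨a + 2 * c, ?_⟩, ⟨a + 2 * d, ?_⟩⟩ <;>
    simp [ha, hb, hc, hd] <;> ring

lemma four_re_eq (x : 𝔻) :
    x - qi * x * qi - qj * x * qj - qk * x * qk = (4 * x.re) • (1 : 𝔻) := by
  ext <;> simp
  ring

lemma four_re_mul_mem {T : Subring 𝔻} (hL : Lip ⊆ T) {g δ : 𝔻} (h : ∀ c ∈ T, g * c * δ ∈ T) :
    (4 * g.re) • δ ∈ T := by
  have hi := hL qi_mem_Lip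
  have hj := hL qj_mem_Lip
  have hk := hL qk_mem_Lip
  have h1 := h 1 T.one_mem
  rw [mul_one] at h1
  have := T.sub_mem (T.sub_mem (T.sub_mem h1 (T.mul_mem hi (h _ hi))) (T.mul_mem hj (h _ hj)))
    (T.mul_mem hk (h _ hk))
  rw [← one_mul δ, ← smul_mul_assoc, ← four_re_eq]
  convert this using 1
  noncomm_ring

/-- If `2 p r` is an integer and `p ε`, `4 r p ε` lie in `T`, then `2 r` is an integer or
`ε ∈ T`. -/
lemma isIntQ_add_self_or_mem {T : Subring 𝔻} {p : ℕ} (hp : p.Prime) (hodd : p ≠ 2) {r : ℚ} {ε : 𝔻}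
    (hε : (p : ℤ) • ε ∈ T) (hr : isIntQ (p * r + p * r))
    (h : (4 * r) • ((p : ℤ) • ε) ∈ T) : isIntQ (r + r) ∨ ε ∈ T := by
  obtain ⟨n, hn⟩ := hr
  by_cases hpn : (p : ℤ) ∣ n
  · left
    obtain ⟨m, rfl⟩ := hpn
    refine ⟨m, ?_⟩
    have hp0 : (p : ℚ) ≠ 0 := by exact_mod_cast hp.ne_zero
    push_cast at hn
    apply mul_left_cancel₀ hp0
    linarith
  · right
    have hp' : Prime (p : ℤ) := Nat.prime_iff_prime_int.1 hp
    have h2 : ¬ (p : ℤ) ∣ 2 * n := by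
      rw [hp'.dvd_mul]
      rintro (h2 | h2)
      · exact hodd ((Nat.prime_dvd_prime_iff_eq hp Nat.prime_two).1 (by exact_mod_cast h2))
      · exact hpn h2
    obtain ⟨x, y, hxy⟩ := (hp'.coprime_iff_not_dvd).2 h2
    have h4 : (4 * r) • ((p : ℤ) • ε) = (2 * n) • ε := by
      have : (4 * r : ℚ) * p = 2 * n := by linarith
      rw [← Int.cast_smul_eq_zsmul ℚ, ← Int.cast_smul_eq_zsmul ℚ, smul_smul]
      push_cast
      rw [this]
    rw [h4] at h
    have := T.add_mem (T.zsmul_mem hε x) (T.zsmul_mem h y)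
    rwa [smul_smul, smul_smul, ← add_smul, hxy, one_smul] at this

/-- For an odd prime `p`, the ideal `p T` is prime. -/
lemma mem_or_mem_of_forall_mul_mem {T : Subring 𝔻} (hL : Lip ⊆ T)
    (h2 : ∀ x ∈ T, x + x ∈ Lip) {p : ℕ} (hp : p.Prime) (hodd : p ≠ 2) {g ε : 𝔻}
    (hg : (p : ℤ) • g ∈ T) (hε : (p : ℤ) • ε ∈ T)
    (h : ∀ c ∈ T, g * c * ((p : ℤ) • ε) ∈ T) : g ∈ T ∨ ε ∈ T := by
  by_contra! hcon
  obtain ⟨hgT, hεT⟩ := hcon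
  obtain ⟨hr, hi, hj, hk⟩ := h2 _ hg
  have key : ∀ u ∈ T, isIntQ (p * (u * g).re + p * (u * g).re) → isIntQ ((u * g).re + (u * g).re) := by
    intro u hu hint
    refine (isIntQ_add_self_or_mem hp hodd hε hint (four_re_mul_mem hL ?_)).resolve_right hεT
    intro c hc
    simpa only [mul_assoc] using T.mul_mem hu (h c hc)
  have neg : ∀ q : ℚ, isIntQ (-q) → isIntQ q := by
    rintro q ⟨z, hz⟩
    exact ⟨-z, by push_cast; linarith⟩
  have neg' : ∀ q : ℚ, isIntQ q → isIntQ (-q) := fun q hq ↦ neg _ (by rwa [neg_neg])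
  have hm : g + g ∈ Lip := by
    refine ⟨?_, ?_, ?_, ?_⟩
    · simpa using key 1 T.one_mem (by simpa using hr)
    · refine neg _ ?_
      simpa [add_comm] using key qi (hL qi_mem_Lip) (by simpa [add_comm] using neg' _ hi)
    · refine neg _ ?_
      simpa [add_comm] using key qj (hL qj_mem_Lip) (by simpa [add_comm] using neg' _ hj)
    · refine neg _ ?_
      simpa [add_comm] using key qk (hL qk_mem_Lip) (by simpa [add_comm] using neg' _ hk)
  obtain ⟨m, rfl⟩ := hp.odd_of_ne_two hodd
  have := T.sub_mem hg (T.zsmul_mem (hL hm) m)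
  apply hgT
  convert this using 1
  push_cast
  module

lemma commutator_mem_of_isRingset {S : Set 𝔻} {T : Subring 𝔻} (hS : IsRingset S T) {g β : 𝔻}
    (hβ : β ∈ S) (hf : C g * (X - C β) ∈ IntPolys S T) {c : 𝔻} (hc : c ∈ T) :
    g * (c * β - β * c) ∈ T := by
  have hcst : (C c : 𝔻[X]) ∈ IntPolys S T := fun α _ ↦ by simpa using hc
  have := hS _ hf _ hcst β hβ
  have e : C g * (X - C β) * C c = C (g * c) * X - C (g * (β * c)) := by
    rw [mul_assoc, sub_mul, X_mul_C, mul_sub, ← mul_assoc, ← C_mul, ← C_mul, ← C_mul]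
  rw [e, eval_sub, eval_C, eval_C_mul, eval_X] at this
  simpa only [mul_sub, mul_assoc, SetLike.mem_coe] using this

lemma mul_commutator_mem_of_isRingset {S : Set 𝔻} {T : Subring 𝔻} (hS : IsRingset S T) {g β : 𝔻}
    (hβ : β ∈ S) (hf : C g * (X - C β) ∈ IntPolys S T) {c d : 𝔻} (hc : c ∈ T) (hd : d ∈ T) :
    g * c * (d * β - β * d) ∈ T := by
  have h1 := commutator_mem_of_isRingset hS hβ hf (T.mul_mem hc hd)
  have h2 := T.mul_mem (commutator_mem_of_isRingset hS hβ hf hc) hd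
  convert T.sub_mem h1 h2 using 1
  noncomm_ring

lemma not_isRingset_of_subring {T : Subring 𝔻} (hL : Lip ⊆ T) (h2 : ∀ x ∈ T, x + x ∈ Lip)
    {S : Set 𝔻} (hsub : S ⊆ T) {p : ℕ} (hp : p.Prime) (hodd : p ≠ 2) {γ : 𝔻} (hγ : γ ∈ T)
    (hγp : (p : 𝔻)⁻¹ * γ ∉ T) {β : 𝔻} (hβ : β ∈ S)
    (hcoef : (∃ c : ℤ, (c : ℚ) = 2 * β.imI ∧ ¬ (p : ℤ) ∣ c) ∨
             (∃ c : ℤ, (c : ℚ) = 2 * β.imJ ∧ ¬ (p : ℤ) ∣ c) ∨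
             (∃ c : ℤ, (c : ℚ) = 2 * β.imK ∧ ¬ (p : ℤ) ∣ c))
    (hf : C ((p : 𝔻)⁻¹ * γ) * (X - C β) ∈ IntPolys S T) : ¬ IsRingset S T := by
  intro hS
  have hp0 : (p : ℚ) ≠ 0 := by exact_mod_cast hp.ne_zero
  have hpD : (p : 𝔻) ≠ 0 := fun h ↦ hp0 (congrArg QuaternionAlgebra.re h)
  have scale : ∀ x : 𝔻, (p : ℤ) • ((p : 𝔻)⁻¹ * x) = x := by
    intro x
    rw [zsmul_eq_mul, Int.cast_natCast, mul_inv_cancel_left₀ hpD]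
  have key : ∀ d ∈ T, (p : 𝔻)⁻¹ * (d * β - β * d) ∈ T := by
    intro d hd
    refine (mem_or_mem_of_forall_mul_mem hL h2 hp hodd (g := (p : 𝔻)⁻¹ * γ) ?_ ?_ ?_).resolve_left
      hγp
    · rwa [scale]
    · rw [scale]
      exact T.sub_mem (T.mul_mem hd (hsub hβ)) (T.mul_mem (hsub hβ) hd)
    · intro c hc
      rw [scale]
      exact mul_commutator_mem_of_isRingset hS hβ hf hc hd
  have hp' : Prime (p : ℤ) := Nat.prime_iff_prime_int.1 hp
  have dvd : ∀ (b : ℚ) (c : ℤ), (c : ℚ) = 2 * b → isIntQ ((p : ℚ)⁻¹ * (b + b) + (p : ℚ)⁻¹ * (b + b)) →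
      (p : ℤ) ∣ c := by
    rintro b c hc ⟨n, hn⟩
    have : (2 * c : ℚ) = p * n := by
      rw [← hn, hc]
      field_simp
      ring
    have h2c : (p : ℤ) ∣ 2 * c := ⟨n, by exact_mod_cast this⟩
    refine (hp'.dvd_mul.1 h2c).resolve_left fun h ↦ hodd ?_
    exact (Nat.prime_dvd_prime_iff_eq hp Nat.prime_two).1 (by exact_mod_cast h)
  have coord : ∀ x : 𝔻, (p : 𝔻)⁻¹ * x = (p : ℚ)⁻¹ • x := by
    intro x
    rw [inv_mul_eq_iff_eq_mul₀ hpD, mul_smul_comm, ← nsmul_eq_mul, ← Nat.cast_smul_eq_nsmul ℚ,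
      smul_smul, inv_mul_cancel₀ hp0, one_smul]
  simp only [coord] at key
  have ki := h2 _ (key qi (hL qi_mem_Lip))
  have kj := h2 _ (key qj (hL qj_mem_Lip))
  rcases hcoef with ⟨c, hc, hpc⟩ | ⟨c, hc, hpc⟩ | ⟨c, hc, hpc⟩
  · refine hpc (dvd (-β.imI) (-c) (by push_cast; linarith) ?_ |> (dvd_neg.1 ·))
    convert kj.2.2.2 using 1
    simp
    ring
  · refine hpc (dvd _ _ hc ?_)
    convert ki.2.2.2 using 1
    simp
  · refine hpc (dvd (-β.imK) (-c) (by push_cast; linarith) ?_ |> (dvd_neg.1 ·))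
    convert ki.2.2.1 using 1
    simp
    ring

/-- If Int(S,R) contains γ(x−β)/p with p an odd prime, γ ∈ R, γ/p ∉ R, and β ∈ S
having an imaginary coefficient b_i with p ∤ 2b_i, then S is not a ringset. -/
theorem stmt_15 (R : Set 𝔻) (hR : R = Lip ∨ R = Hur)
    (S : Set 𝔻) (hsub : S ⊂ R) (hred : IsReducedIn S R)
    (p : ℕ) (hp : p.Prime) (hodd : p ≠ 2)
    (γ : 𝔻) (hγ : γ ∈ R) (hγp : (p : 𝔻)⁻¹ * γ ∉ R)
    (β : 𝔻) (hβ : β ∈ S)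
    (hcoef : (∃ c : ℤ, (c : ℚ) = 2 * β.imI ∧ ¬ (p : ℤ) ∣ c) ∨
             (∃ c : ℤ, (c : ℚ) = 2 * β.imJ ∧ ¬ (p : ℤ) ∣ c) ∨
             (∃ c : ℤ, (c : ℚ) = 2 * β.imK ∧ ¬ (p : ℤ) ∣ c))
    (hf : C ((p : 𝔻)⁻¹ * γ) * (X - C β) ∈ IntPolys S R) :
    ¬ IsRingset S R := by
  rcases hR with rfl | rfl
  · exact not_isRingset_of_subring (T := lipSubring) subset_rfl
      (fun x hx ↦ lipSubring.add_mem hx hx) hsub.subset hp hodd hγ hγp hβ hcoef hf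
  · exact not_isRingset_of_subring (T := hurSubring) Set.subset_union_left
      (fun x hx ↦ add_self_mem_Lip_of_mem_Hur hx) hsub.subset hp hodd hγ hγp hβ hcoef hf
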